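/- arXiv:1406.2111 — 2 statements merged into one kernel-verified Lean document; each statement's English description precedes it below -/
import Mathlib

section
/- Let k ≥ 2 be an integer and let n ≥ 2k. Consider the saturation game (n, M_k), where M_k is the property of admitting a matching of size k. If Max is the first player and k is even, or Mini is the first player and k is odd, then Max has a strategy guaranteeing that the graph at the end of the game has at least n−1 edges; in particular s(n, M_k) ≥ n−1 in these cases. -/
open SimpleGraph

/-- The graph obtained from `G` by adding the edge `e`. -/
def addEdge {V : Type*} (G : SimpleGraph V) (e : Sym2 V) : SimpleGraph V :=
  G ⊔ SimpleGraph.fromEdgeSet {e}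

/-- In the saturation game for the monotone property `P`, a move `e` is legal in
position `G` if `e` is a non-loop non-edge of `G` whose addition keeps `P` unsatisfied. -/
def legalMove {V : Type*} (P : SimpleGraph V → Prop) (G : SimpleGraph V) (e : Sym2 V) : Prop :=
  ¬ e.IsDiag ∧ e ∉ G.edgeSet ∧ ¬ P (addEdge G e)

/-- `GameEnsures P Q turn G` : in the saturation game for the property `P`, played from
position `G` where the protagonist is to move iff `turn = true`, the protagonist has a
strategy guaranteeing that the final (`P`-saturated) graph satisfies `Q`. -/
inductive GameEnsures {V : Type*} (P Q : SimpleGraph V → Prop) : Bool → SimpleGraph V → Prop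
  | gameOver (turn : Bool) (G : SimpleGraph V)
      (hend : ∀ e, ¬ legalMove P G e) (hQ : Q G) : GameEnsures P Q turn G
  | protagonistMove (G : SimpleGraph V) (e : Sym2 V) (hl : legalMove P G e)
      (h : GameEnsures P Q false (addEdge G e)) : GameEnsures P Q true G
  | opponentMove (G : SimpleGraph V) (e₀ : Sym2 V) (hl : legalMove P G e₀)
      (h : ∀ e, legalMove P G e → GameEnsures P Q true (addEdge G e)) :
      GameEnsures P Q false G

/-- The property of admitting a matching of size `k`. -/
def hasMatchingOfSize {V : Type*} (k : ℕ) (G : SimpleGraph V) : Prop :=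
  ∃ M : G.Subgraph, M.IsMatching ∧ M.edgeSet.ncard = k

section Matchings

variable {V : Type*}

/-- A finite set of pairwise disjoint non-loop edges. -/
def IsEdgeMatching (N : Finset (Sym2 V)) : Prop :=
  (∀ e ∈ N, ¬ e.IsDiag) ∧ ∀ e ∈ N, ∀ f ∈ N, ∀ v, v ∈ e → v ∈ f → e = f

lemma IsEdgeMatching.subset {M N : Finset (Sym2 V)} (hN : IsEdgeMatching N) (h : M ⊆ N) :
    IsEdgeMatching M :=
  ⟨fun e he => hN.1 e (h he), fun e he f hf => hN.2 e (h he) f (h hf)⟩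

lemma hasMatchingOfSize_iff [Finite V] {k : ℕ} {G : SimpleGraph V} :
    hasMatchingOfSize k G ↔
      ∃ N : Finset (Sym2 V), IsEdgeMatching N ∧ (↑N : Set (Sym2 V)) ⊆ G.edgeSet ∧ N.card = k := by
  constructor
  · rintro ⟨M, hM, hk⟩
    have hfin : M.edgeSet.Finite := Set.toFinite _
    refine ⟨hfin.toFinset, ⟨?_, ?_⟩, ?_, ?_⟩
    · intro e he
      exact G.not_isDiag_of_mem_edgeSet (M.edgeSet_subset (by simpa using he))
    · intro e he f hf v hve hvf
      obtain ⟨a, rfl⟩ := Sym2.mem_iff_exists.1 hve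
      obtain ⟨b, rfl⟩ := Sym2.mem_iff_exists.1 hvf
      have ha : M.Adj v a := by simpa using he
      have hb : M.Adj v b := by simpa using hf
      rw [hM.eq_of_adj_left ha hb]
    · simpa using M.edgeSet_subset
    · rw [← hk, Set.ncard_eq_toFinset_card _ hfin]
  · rintro ⟨N, hN, hNG, rfl⟩
    let M : G.Subgraph :=
      { verts := {v | ∃ e ∈ N, v ∈ e}
        Adj := fun a b => s(a, b) ∈ N
        adj_sub := fun {a b} h => by simpa using hNG h
        edge_vert := fun {a b} h => ⟨_, h, Sym2.mem_mk_left a b⟩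
        symm := ⟨fun a b h => by rwa [Sym2.eq_swap]⟩ }
    refine ⟨M, ?_, ?_⟩
    · rintro v ⟨e, he, hve⟩
      obtain ⟨a, rfl⟩ := Sym2.mem_iff_exists.1 hve
      refine ⟨a, he, fun b hb => ?_⟩
      have := hN.2 _ hb _ he v (Sym2.mem_mk_left v b) hve
      exact Sym2.congr_right.1 this
    · have : M.edgeSet = (↑N : Set (Sym2 V)) := by
        ext e
        induction e with
        | _ a b => rfl
      rw [this, Set.ncard_coe_finset]

variable [DecidableEq V]

/-- The vertices covered by a finite set of edges. -/
def edgeSupport (N : Finset (Sym2 V)) : Finset V := N.biUnion Sym2.toFinset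

lemma mem_edgeSupport {N : Finset (Sym2 V)} {v : V} :
    v ∈ edgeSupport N ↔ ∃ e ∈ N, v ∈ e := by
  simp [edgeSupport]

lemma edgeSupport_insert (e : Sym2 V) (N : Finset (Sym2 V)) :
    edgeSupport (insert e N) = e.toFinset ∪ edgeSupport N := by
  simp [edgeSupport, Finset.biUnion_insert]

lemma IsEdgeMatching.card_edgeSupport {N : Finset (Sym2 V)} (hN : IsEdgeMatching N) :
    (edgeSupport N).card = 2 * N.card := by
  rw [edgeSupport, Finset.card_biUnion]
  · rw [Finset.sum_congr rfl fun e he => Sym2.card_toFinset_of_not_isDiag e (hN.1 e he)]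
    simp [mul_comm]
  · intro e he f hf hef
    refine Finset.disjoint_left.2 fun v hv hv' => ?_
    exact hef (hN.2 e he f hf v (by simpa using hv) (by simpa using hv'))

lemma IsEdgeMatching.insert_edge {N : Finset (Sym2 V)} (hN : IsEdgeMatching N) {a b : V}
    (hab : a ≠ b) (ha : a ∉ edgeSupport N) (hb : b ∉ edgeSupport N) :
    IsEdgeMatching (insert s(a, b) N) := by
  rw [mem_edgeSupport] at ha hb
  push Not at ha hb
  refine ⟨?_, ?_⟩
  · intro e he
    rcases Finset.mem_insert.1 he with rfl | he
    · simpa using hab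
    · exact hN.1 e he
  · intro e he f hf v hve hvf
    rcases Finset.mem_insert.1 he with rfl | he' <;> rcases Finset.mem_insert.1 hf with rfl | hf'
    · rfl
    · rcases Sym2.mem_iff.1 hve with rfl | rfl
      · exact absurd hvf (ha f hf')
      · exact absurd hvf (hb f hf')
    · rcases Sym2.mem_iff.1 hvf with rfl | rfl
      · exact absurd hve (ha e he')
      · exact absurd hve (hb e he')
    · exact hN.2 e he' f hf' v hve hvf

lemma card_insert_of_notMem_edgeSupport {N : Finset (Sym2 V)} {a b : V}
    (ha : a ∉ edgeSupport N) : (insert s(a, b) N).card = N.card + 1 := by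
  apply Finset.card_insert_of_notMem
  intro h
  exact ha (mem_edgeSupport.2 ⟨_, h, Sym2.mem_mk_left a b⟩)

lemma IsEdgeMatching.notMem_edgeSupport_erase {N : Finset (Sym2 V)} (hN : IsEdgeMatching N)
    {e : Sym2 V} (he : e ∈ N) {v : V} (hv : v ∈ e) : v ∉ edgeSupport (N.erase e) := by
  rw [mem_edgeSupport]
  rintro ⟨f, hf, hvf⟩
  rw [Finset.mem_erase] at hf
  exact hf.1 (hN.2 f hf.2 e he v hvf hv)

/-- The augmentation property of matchings. -/
lemma IsEdgeMatching.exists_augment {N M : Finset (Sym2 V)} (hN : IsEdgeMatching N)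
    (hM : IsEdgeMatching M) (h : N.card < M.card) :
    ∃ N' ⊆ N ∪ M, IsEdgeMatching N' ∧ N'.card = N.card + 1 ∧
      edgeSupport N ⊆ edgeSupport N' := by
  induction hm : M.card generalizing N M with
  | zero => omega
  | succ m ih =>
  obtain ⟨x, hxM, hxN⟩ : ∃ x ∈ edgeSupport M, x ∉ edgeSupport N :=
    Finset.exists_mem_notMem_of_card_lt_card
      (by rw [hN.card_edgeSupport, hM.card_edgeSupport]; omega)
  obtain ⟨e, heM, hxe⟩ := mem_edgeSupport.1 hxM
  obtain ⟨a, rfl⟩ := Sym2.mem_iff_exists.1 hxe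
  have hxa : x ≠ a := by simpa using hM.1 _ heM
  by_cases haN : a ∈ edgeSupport N
  · obtain ⟨f, hfN, haf⟩ := mem_edgeSupport.1 haN
    obtain ⟨b, rfl⟩ := Sym2.mem_iff_exists.1 haf
    have hab : a ≠ b := by simpa using hN.1 _ hfN
    have hNc := Finset.card_erase_add_one hfN
    have hMc := Finset.card_erase_add_one heM
    obtain ⟨L, hLs, hL, hLc, hLsup⟩ := ih (hN.subset (Finset.erase_subset s(a, b) N))
      (hM.subset (Finset.erase_subset s(x, a) M)) (by omega) (by omega)
    have hLsupp : ∀ v ∈ edgeSupport L,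
        v ∈ edgeSupport (N.erase s(a, b)) ∨ v ∈ edgeSupport (M.erase s(x, a)) := by
      intro v hv
      obtain ⟨g, hg, hvg⟩ := mem_edgeSupport.1 hv
      rcases Finset.mem_union.1 (hLs hg) with hg | hg
      · exact Or.inl (mem_edgeSupport.2 ⟨g, hg, hvg⟩)
      · exact Or.inr (mem_edgeSupport.2 ⟨g, hg, hvg⟩)
    have haL : a ∉ edgeSupport L := fun h => (hLsupp a h).elim
      (hN.notMem_edgeSupport_erase hfN (Sym2.mem_mk_left a b))
      (hM.notMem_edgeSupport_erase heM (Sym2.mem_mk_right x a))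
    have hxL : x ∉ edgeSupport L := fun h => (hLsupp x h).elim
      (fun h => hxN <| by
        obtain ⟨g, hg, hvg⟩ := mem_edgeSupport.1 h
        exact mem_edgeSupport.2 ⟨g, Finset.mem_of_mem_erase hg, hvg⟩)
      (hM.notMem_edgeSupport_erase heM (Sym2.mem_mk_left x a))
    have hLs' : L ⊆ N ∪ M := hLs.trans
      (Finset.union_subset_union (Finset.erase_subset _ _) (Finset.erase_subset _ _))
    have hNsup : edgeSupport N = s(a, b).toFinset ∪ edgeSupport (N.erase s(a, b)) := by
      rw [← edgeSupport_insert, Finset.insert_erase hfN]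
    by_cases hbL : b ∈ edgeSupport L
    · refine ⟨insert s(x, a) L, ?_, hL.insert_edge hxa hxL haL, ?_, ?_⟩
      · exact Finset.insert_subset (Finset.mem_union_right _ heM) hLs'
      · rw [card_insert_of_notMem_edgeSupport hxL]; omega
      · rw [hNsup, edgeSupport_insert]
        intro v hv
        rcases Finset.mem_union.1 hv with hv | hv
        · have : v = a ∨ v = b := by simpa using hv
          rcases this with rfl | rfl
          · simp
          · exact Finset.mem_union_right _ hbL
        · exact Finset.mem_union_right _ (hLsup hv)
    · refine ⟨insert s(a, b) L, ?_, hL.insert_edge hab haL hbL, ?_, ?_⟩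
      · exact Finset.insert_subset (Finset.mem_union_left _ hfN) hLs'
      · rw [card_insert_of_notMem_edgeSupport haL]; omega
      · rw [hNsup, edgeSupport_insert]
        exact Finset.union_subset_union le_rfl hLsup
  · refine ⟨insert s(x, a) N, ?_, hN.insert_edge hxa hxN haN,
      card_insert_of_notMem_edgeSupport hxN, ?_⟩
    · exact Finset.insert_subset (Finset.mem_union_right _ heM) Finset.subset_union_left
    · rw [edgeSupport_insert]
      exact Finset.subset_union_right

end Matchings

section Game

variable {V : Type*}

lemma edgeSet_addEdge {G : SimpleGraph V} {e : Sym2 V} (he : ¬ e.IsDiag) :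
    (addEdge G e).edgeSet = insert e G.edgeSet := by
  ext f
  simp only [addEdge, edgeSet_sup, edgeSet_fromEdgeSet, Set.mem_union, Set.mem_sdiff,
    Set.mem_singleton_iff, Set.mem_insert_iff]
  constructor
  · tauto
  · rintro (rfl | h)
    · exact Or.inr ⟨rfl, he⟩
    · exact Or.inl h

lemma mem_edgeSet_addEdge {G : SimpleGraph V} {e f : Sym2 V} (he : ¬ e.IsDiag) :
    f ∈ (addEdge G e).edgeSet ↔ f = e ∨ f ∈ G.edgeSet := by
  rw [edgeSet_addEdge he, Set.mem_insert_iff]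

lemma le_addEdge (G : SimpleGraph V) (e : Sym2 V) : G ≤ addEdge G e := le_sup_left

variable [Finite V]

lemma ncard_edgeSet_addEdge {P : SimpleGraph V → Prop} {G : SimpleGraph V} {e : Sym2 V}
    (h : legalMove P G e) : (addEdge G e).edgeSet.ncard = G.edgeSet.ncard + 1 := by
  rw [edgeSet_addEdge h.1, Set.ncard_insert_of_notMem h.2.1]

lemma ncard_compl_edgeSet_addEdge {P : SimpleGraph V → Prop} {G : SimpleGraph V} {e : Sym2 V}
    (h : legalMove P G e) : (addEdge G e).edgeSetᶜ.ncard < G.edgeSetᶜ.ncard := by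
  refine Set.ncard_lt_ncard
    ⟨Set.compl_subset_compl.2 (edgeSet_mono (le_addEdge G e)), fun hs => ?_⟩ (Set.toFinite _)
  have := hs h.2.1
  rw [edgeSet_addEdge h.1] at this
  exact this (Set.mem_insert _ _)

/-- The protagonist wins from any position all of whose `P`-saturated extensions satisfy `Q`. -/
lemma gameEnsures_of_forall_saturated {P Q : SimpleGraph V → Prop} (turn : Bool)
    (G : SimpleGraph V) (hP : ¬ P G)
    (h : ∀ G', G ≤ G' → ¬ P G' → (∀ e, ¬ legalMove P G' e) → Q G') :
    GameEnsures P Q turn G := by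
  induction hm : G.edgeSetᶜ.ncard using Nat.strong_induction_on generalizing G turn with
  | _ m ih =>
  by_cases hend : ∀ e, ¬ legalMove P G e
  · exact .gameOver _ _ hend (h G le_rfl hP hend)
  · have key : ∀ t e, legalMove P G e → GameEnsures P Q t (addEdge G e) := fun t e he =>
      ih _ (hm ▸ ncard_compl_edgeSet_addEdge he) t _ he.2.2
        (fun G' hG' => h G' ((le_addEdge G e).trans hG')) rfl
    push Not at hend
    obtain ⟨e, he⟩ := hend
    cases turn
    · exact .opponentMove _ e he (key true)
    · exact .protagonistMove _ e he (key false e he)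

end Game

section MatchingGame

variable {V : Type*} [DecidableEq V]

/-- The graph has a matching of size at most `k` covering all non-isolated vertices. -/
def HasCoveringMatching (k : ℕ) (G : SimpleGraph V) : Prop :=
  ∃ N : Finset (Sym2 V), IsEdgeMatching N ∧ (↑N : Set (Sym2 V)) ⊆ G.edgeSet ∧ N.card ≤ k ∧
    ∀ e ∈ G.edgeSet, ∀ v ∈ e, v ∈ edgeSupport N

lemma hasCoveringMatching_bot (k : ℕ) : HasCoveringMatching k (⊥ : SimpleGraph V) :=
  ⟨∅, by simp [IsEdgeMatching], by simp, by simp, by simp⟩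

/-- Extending a covering matching by a disjoint edge which touches all new edges. -/
lemma hasCoveringMatching_of_insert {k : ℕ} {G G' : SimpleGraph V} {N : Finset (Sym2 V)}
    (hN : IsEdgeMatching N) (hNG : (↑N : Set (Sym2 V)) ⊆ G.edgeSet) (hNk : N.card < k)
    (hle : G ≤ G') {a b : V} (hab : G'.Adj a b) (ha : a ∉ edgeSupport N) (hb : b ∉ edgeSupport N)
    (hcov : ∀ e ∈ G'.edgeSet, ∀ v ∈ e, v = a ∨ v = b ∨ v ∈ edgeSupport N) :
    HasCoveringMatching k G' := by
  refine ⟨insert s(a, b) N, hN.insert_edge hab.ne ha hb, ?_, ?_, ?_⟩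
  · rw [Finset.coe_insert]
    exact Set.insert_subset (by simpa using hab) (hNG.trans (edgeSet_mono hle))
  · rw [card_insert_of_notMem_edgeSupport ha]; omega
  · intro e he v hv
    rw [edgeSupport_insert]
    simpa [or_assoc] using hcov e he v hv

/-- A clique covered by a perfect matching of size `m` has `m (2 m - 1)` edges, a number of the
same parity as `m`. -/
lemma even_ncard_edgeSet_add_card {G : SimpleGraph V} {N : Finset (Sym2 V)}
    (hN : IsEdgeMatching N) (hcov : ∀ e ∈ G.edgeSet, ∀ v ∈ e, v ∈ edgeSupport N)
    (hcomp : ∀ a ∈ edgeSupport N, ∀ b ∈ edgeSupport N, a ≠ b → G.Adj a b) :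
    Even (G.edgeSet.ncard + N.card) := by
  have hset : G.edgeSet = ↑((edgeSupport N).offDiag.image Sym2.mk.uncurry) := by
    ext e
    induction e with
    | _ a b =>
    simp only [Finset.coe_image, Set.mem_image, Finset.mem_coe, Finset.mem_offDiag]
    constructor
    · intro h
      exact ⟨(a, b), ⟨hcov _ h a (Sym2.mem_mk_left a b), hcov _ h b (Sym2.mem_mk_right a b),
        (G.mem_edgeSet.1 h).ne⟩, rfl⟩
    · rintro ⟨⟨c, d⟩, ⟨hc, hd, hcd⟩, h⟩
      rw [← h]
      exact hcomp c hc d hd hcd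
  rw [hset, Set.ncard_coe_finset, Sym2.card_image_offDiag, hN.card_edgeSupport,
    Nat.choose_two_right, mul_assoc, Nat.mul_div_cancel_left _ two_pos]
  rcases Nat.eq_zero_or_pos N.card with h0 | hpos
  · simp [h0]
  · obtain ⟨j, hj⟩ := Nat.exists_eq_add_of_lt hpos
    refine ⟨N.card * N.card, ?_⟩
    rw [hj, show 2 * (0 + j + 1) - 1 = 2 * j + 1 by omega]
    ring

variable [Fintype V]

lemma not_hasMatchingOfSize_of_forall_mem {k : ℕ} {G : SimpleGraph V} (U : Finset V)
    (hU : U.card < 2 * k) (h : ∀ e ∈ G.edgeSet, ∀ v ∈ e, v ∈ U) : ¬ hasMatchingOfSize k G := by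
  rw [hasMatchingOfSize_iff]
  rintro ⟨N, hN, hNG, rfl⟩
  have hsub : edgeSupport N ⊆ U := by
    intro v hv
    obtain ⟨e, he, hve⟩ := mem_edgeSupport.1 hv
    exact h e (hNG he) v hve
  have := Finset.card_le_card hsub
  rw [hN.card_edgeSupport] at this
  omega

lemma card_sub_one_le_ncard_edgeSet {G : SimpleGraph V} {c : V} (h : ∀ w, w ≠ c → G.Adj c w) :
    Fintype.card V - 1 ≤ G.edgeSet.ncard := by
  have hinj : Set.InjOn (fun w => s(c, w)) (↑(Finset.univ.erase c) : Set V) := by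
    intro a _ b _ hab
    exact Sym2.congr_right.1 hab
  calc Fintype.card V - 1 = (Finset.univ.erase c).card := by
        rw [Finset.card_erase_of_mem (Finset.mem_univ c), Finset.card_univ]
    _ = ((fun w => s(c, w)) '' (↑(Finset.univ.erase c) : Set V)).ncard := by
        rw [hinj.ncard_image, Set.ncard_coe_finset]
    _ ≤ G.edgeSet.ncard := by
        refine Set.ncard_le_ncard ?_ (Set.toFinite _)
        rintro _ ⟨w, hw, rfl⟩
        exact h w (by simpa using hw)

/-- In a saturated graph, a vertex covered by all matchings of size `k` is dominating. -/
lemma adj_of_forall_mem_edgeSupport {k : ℕ} {G : SimpleGraph V} {c : V}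
    (hP : ¬ hasMatchingOfSize (k + 1) G) (hend : ∀ e, ¬ legalMove (hasMatchingOfSize (k + 1)) G e)
    (hc : ∀ N : Finset (Sym2 V), IsEdgeMatching N → (↑N : Set (Sym2 V)) ⊆ G.edgeSet →
      N.card = k → c ∈ edgeSupport N) (w : V) (hw : w ≠ c) : G.Adj c w := by
  by_contra hadj
  have hdiag : ¬ s(c, w).IsDiag := by simpa using hw.symm
  refine hend s(c, w) ⟨hdiag, by simpa using hadj, fun hmatch => ?_⟩
  obtain ⟨N, hN, hNG, hNc⟩ := hasMatchingOfSize_iff.1 hmatch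
  rw [edgeSet_addEdge hdiag] at hNG
  by_cases hcw : s(c, w) ∈ N
  · refine hN.notMem_edgeSupport_erase hcw (Sym2.mem_mk_left c w)
      (hc _ (hN.subset (Finset.erase_subset _ _)) ?_ ?_)
    · intro e he
      have he' := Finset.mem_erase.1 (Finset.mem_coe.1 he)
      exact (hNG he'.2).resolve_left he'.1
    · rw [Finset.card_erase_of_mem hcw]; omega
  · refine hP (hasMatchingOfSize_iff.2 ⟨N, hN, fun e he => (hNG he).resolve_left ?_, hNc⟩)
    rintro rfl
    exact hcw he

/-- A vertex `c` covered by a matching of size `k` with two neighbours outside the matching is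
covered by all matchings of size `k`, provided there is no matching of size `k + 1`. -/
lemma mem_edgeSupport_of_two_neighbors {k : ℕ} {G : SimpleGraph V}
    (hP : ¬ hasMatchingOfSize (k + 1) G) {N : Finset (Sym2 V)} (hN : IsEdgeMatching N)
    (hNG : (↑N : Set (Sym2 V)) ⊆ G.edgeSet) (hNk : N.card = k) {c x y : V}
    (hc : c ∈ edgeSupport N) (hx : x ∉ edgeSupport N) (hy : y ∉ edgeSupport N) (hxy : x ≠ y)
    (hcx : G.Adj c x) (hcy : G.Adj c y) {M : Finset (Sym2 V)} (hM : IsEdgeMatching M)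
    (hMG : (↑M : Set (Sym2 V)) ⊆ G.edgeSet) (hMk : M.card = k) : c ∈ edgeSupport M := by
  by_contra hcM
  obtain ⟨e, heN, hce⟩ := mem_edgeSupport.1 hc
  obtain ⟨d, rfl⟩ := Sym2.mem_iff_exists.1 hce
  have hcd : G.Adj c d := by simpa using hNG heN
  have hd : d ∈ edgeSupport N := mem_edgeSupport.2 ⟨_, heN, Sym2.mem_mk_right c d⟩
  have hNc := Finset.card_erase_add_one heN
  have hN₀ := hN.subset (Finset.erase_subset s(c, d) N)
  obtain ⟨L, hLs, hL, hLc, hLsup⟩ := hN₀.exists_augment hM (by omega)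
  have hLG : (↑L : Set (Sym2 V)) ⊆ G.edgeSet := by
    intro f hf
    rcases Finset.mem_union.1 (hLs hf) with hf | hf
    · exact hNG (Finset.mem_of_mem_erase hf)
    · exact hMG hf
  have hcL : c ∉ edgeSupport L := by
    intro h
    obtain ⟨f, hf, hcf⟩ := mem_edgeSupport.1 h
    rcases Finset.mem_union.1 (hLs hf) with hf | hf
    · exact hN.notMem_edgeSupport_erase heN hce (mem_edgeSupport.2 ⟨f, hf, hcf⟩)
    · exact hcM (mem_edgeSupport.2 ⟨f, hf, hcf⟩)
  have hcov : ∀ t, G.Adj c t → t ∈ edgeSupport L := by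
    intro t ht
    by_contra htL
    refine hP (hasMatchingOfSize_iff.2
      ⟨insert s(c, t) L, hL.insert_edge ht.ne hcL htL, ?_, ?_⟩)
    · rw [Finset.coe_insert]
      exact Set.insert_subset (by simpa using ht) hLG
    · rw [card_insert_of_notMem_edgeSupport hcL]; omega
  have hsup : edgeSupport (N.erase s(c, d)) ⊆ edgeSupport N :=
    Finset.biUnion_subset_biUnion_of_subset_left _ (Finset.erase_subset _ _)
  have hd₀ : d ∉ edgeSupport (N.erase s(c, d)) :=
    hN.notMem_edgeSupport_erase heN (Sym2.mem_mk_right c d)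
  have hsub : insert x (insert y (insert d (edgeSupport (N.erase s(c, d))))) ⊆ edgeSupport L :=
    Finset.insert_subset (hcov x hcx) (Finset.insert_subset (hcov y hcy)
      (Finset.insert_subset (hcov d hcd) hLsup))
  have hcard := Finset.card_le_card hsub
  rw [Finset.card_insert_of_notMem, Finset.card_insert_of_notMem,
    Finset.card_insert_of_notMem hd₀, hN₀.card_edgeSupport, hL.card_edgeSupport] at hcard
  · omega
  · rw [Finset.mem_insert]
    rintro (rfl | h)
    · exact hy hd
    · exact hy (hsup h)
  · rw [Finset.mem_insert, Finset.mem_insert]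
    rintro (h | rfl | h)
    · exact hxy h
    · exact hx hd
    · exact hx (hsup h)

lemma HasCoveringMatching.not_hasMatchingOfSize {k : ℕ} {G : SimpleGraph V}
    (h : HasCoveringMatching k G) : ¬ hasMatchingOfSize (k + 1) G := by
  obtain ⟨N, hN, -, hNk, hcov⟩ := h
  exact not_hasMatchingOfSize_of_forall_mem _ (by rw [hN.card_edgeSupport]; omega) hcov

lemma IsEdgeMatching.exists_notMem_edgeSupport {N : Finset (Sym2 V)} (hN : IsEdgeMatching N)
    (h : 2 * (N.card + 1) ≤ Fintype.card V) (x : V) : ∃ y, y ∉ edgeSupport N ∧ y ≠ x := by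
  obtain ⟨y, -, hy⟩ := Finset.exists_mem_notMem_of_card_lt_card
    (s := insert x (edgeSupport N)) (t := Finset.univ)
    (by
      have := Finset.card_insert_le x (edgeSupport N)
      rw [hN.card_edgeSupport] at this
      rw [Finset.card_univ]
      omega)
  rw [Finset.mem_insert, not_or] at hy
  exact ⟨y, hy.2, hy.1⟩

/-- With Max to move, a suitable edge count parity lets Max keep a covering matching. -/
lemma HasCoveringMatching.exists_move {k : ℕ} {G : SimpleGraph V}
    (hV : 2 * (k + 1) ≤ Fintype.card V) (h : HasCoveringMatching k G)
    (hpar : Odd (G.edgeSet.ncard + k)) :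
    ∃ e, legalMove (hasMatchingOfSize (k + 1)) G e ∧ HasCoveringMatching k (addEdge G e) := by
  obtain ⟨N, hN, hNG, hNk, hcov⟩ := h
  suffices ∃ e : Sym2 V, ¬ e.IsDiag ∧ e ∉ G.edgeSet ∧ HasCoveringMatching k (addEdge G e) by
    obtain ⟨e, h1, h2, h3⟩ := this
    exact ⟨e, ⟨h1, h2, h3.not_hasMatchingOfSize⟩, h3⟩
  by_cases hcomp : ∀ a ∈ edgeSupport N, ∀ b ∈ edgeSupport N, a ≠ b → G.Adj a b
  · have heven := even_ncard_edgeSet_add_card hN hcov hcomp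
    have hlt : N.card < k := by
      refine lt_of_le_of_ne hNk ?_
      rintro rfl
      exact Nat.not_even_iff_odd.2 hpar heven
    obtain ⟨a, ha⟩ : ∃ a, a ∉ edgeSupport N := by
      have hlt' : (edgeSupport N).card < (Finset.univ : Finset V).card := by
        rw [hN.card_edgeSupport, Finset.card_univ]
        omega
      obtain ⟨a, -, ha⟩ := Finset.exists_mem_notMem_of_card_lt_card hlt'
      exact ⟨a, ha⟩
    obtain ⟨b, hb, hba⟩ := hN.exists_notMem_edgeSupport (by omega) a
    have hdiag : ¬ s(a, b).IsDiag := by simpa using hba.symm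
    refine ⟨s(a, b), hdiag, fun h => ha (hcov _ h a (Sym2.mem_mk_left a b)), ?_⟩
    refine hasCoveringMatching_of_insert hN hNG hlt (le_addEdge G _) (a := a) (b := b)
      ((mem_edgeSet_addEdge hdiag).2 (Or.inl rfl)) ha hb fun e he v hv => ?_
    rcases (mem_edgeSet_addEdge hdiag).1 he with rfl | he
    · rcases Sym2.mem_iff.1 hv with h | h <;> simp [h]
    · exact Or.inr (Or.inr (hcov e he v hv))
  · push Not at hcomp
    obtain ⟨a, ha, b, hb, hab, hadj⟩ := hcomp
    have hdiag : ¬ s(a, b).IsDiag := by simpa using hab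
    refine ⟨s(a, b), hdiag, by simpa using hadj, N, hN,
      hNG.trans (edgeSet_mono (le_addEdge G _)), hNk, fun e he v hv => ?_⟩
    rcases (mem_edgeSet_addEdge hdiag).1 he with rfl | he
    · rcases Sym2.mem_iff.1 hv with rfl | rfl <;> assumption
    · exact hcov e he v hv

lemma HasCoveringMatching.exists_legalMove {k : ℕ} {G : SimpleGraph V} (hk : 1 ≤ k)
    (hV : 2 * (k + 1) ≤ Fintype.card V) (h : HasCoveringMatching k G) :
    ∃ e, legalMove (hasMatchingOfSize (k + 1)) G e := by
  obtain ⟨N, hN, hNG, hNk, hcov⟩ := h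
  have hpos : 0 < Fintype.card V := by omega
  obtain ⟨z⟩ := Fintype.card_pos_iff.1 hpos
  obtain ⟨a, ha, -⟩ := hN.exists_notMem_edgeSupport (by omega) z
  obtain ⟨c, hca, hc⟩ : ∃ c, c ≠ a ∧ (insert a (insert c (edgeSupport N))).card < 2 * (k + 1) := by
    rcases (edgeSupport N).eq_empty_or_nonempty with hem | ⟨c, hc⟩
    · obtain ⟨c, -, hca⟩ := hN.exists_notMem_edgeSupport (by omega) a
      refine ⟨c, hca, ?_⟩
      have := Finset.card_insert_le c (edgeSupport N)
      have := Finset.card_insert_le a (insert c (edgeSupport N))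
      rw [hem, Finset.card_empty] at *
      omega
    · refine ⟨c, fun h => ha (h ▸ hc), ?_⟩
      rw [Finset.insert_eq_of_mem hc]
      have := Finset.card_insert_le a (edgeSupport N)
      rw [hN.card_edgeSupport] at this
      omega
  have hdiag : ¬ s(a, c).IsDiag := by simpa using hca.symm
  refine ⟨s(a, c), hdiag, fun h => ha (hcov _ h a (Sym2.mem_mk_left a c)),
    not_hasMatchingOfSize_of_forall_mem _ hc fun e he v hv => ?_⟩
  rcases (mem_edgeSet_addEdge hdiag).1 he with rfl | he
  · rcases Sym2.mem_iff.1 hv with rfl | rfl <;> simp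
  · simp [hcov e he v hv]

/-- When Mini joins a covered vertex to an isolated vertex, Max has a good answer. -/
lemma exists_answer {k : ℕ} {G : SimpleGraph V} (hV : 2 * (k + 1) ≤ Fintype.card V)
    {N : Finset (Sym2 V)} (hN : IsEdgeMatching N) (hNG : (↑N : Set (Sym2 V)) ⊆ G.edgeSet)
    (hNk : N.card ≤ k) (hcov : ∀ e ∈ G.edgeSet, ∀ v ∈ e, v ∈ edgeSupport N) {c x : V}
    (hc : c ∈ edgeSupport N) (hx : x ∉ edgeSupport N) :
    ∃ e, legalMove (hasMatchingOfSize (k + 1)) (addEdge G s(c, x)) e ∧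
      (HasCoveringMatching k (addEdge (addEdge G s(c, x)) e) ∨
        GameEnsures (hasMatchingOfSize (k + 1))
          (fun G : SimpleGraph V => Fintype.card V - 1 ≤ G.edgeSet.ncard) false
          (addEdge (addEdge G s(c, x)) e)) := by
  obtain ⟨y, hy, hyx⟩ := hN.exists_notMem_edgeSupport (by omega) x
  have hcx : c ≠ x := fun h => hx (h ▸ hc)
  have hcy : c ≠ y := fun h => hy (h ▸ hc)
  have hd₁ : ¬ s(c, x).IsDiag := by simpa using hcx
  have hcov₁ : ∀ e ∈ (addEdge G s(c, x)).edgeSet, ∀ v ∈ e, v = x ∨ v ∈ edgeSupport N := by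
    intro e he v hv
    rcases (mem_edgeSet_addEdge hd₁).1 he with rfl | he
    · rcases Sym2.mem_iff.1 hv with rfl | rfl
      · exact Or.inr hc
      · exact Or.inl rfl
    · exact Or.inr (hcov e he v hv)
  have hcov₂ : ∀ z, z ≠ y → (z = x ∨ z ∈ edgeSupport N) →
      ∀ e ∈ (addEdge (addEdge G s(c, x)) s(z, y)).edgeSet, ∀ v ∈ e,
        v = x ∨ v = y ∨ v ∈ edgeSupport N := by
    intro z hzy hz e he v hv
    rcases (mem_edgeSet_addEdge (by simpa using hzy)).1 he with rfl | he
    · rcases Sym2.mem_iff.1 hv with rfl | rfl <;> tauto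
    · have := hcov₁ e he v hv
      tauto
  have hnew : ∀ z, s(z, y) ∉ (addEdge G s(c, x)).edgeSet := fun z h =>
    (hcov₁ _ h y (Sym2.mem_mk_right z y)).elim hyx hy
  rcases lt_or_eq_of_le hNk with hlt | heq
  · have hd₂ : ¬ s(x, y).IsDiag := by simpa using hyx.symm
    have hcm : HasCoveringMatching k (addEdge (addEdge G s(c, x)) s(x, y)) :=
      hasCoveringMatching_of_insert hN hNG hlt ((le_addEdge G _).trans (le_addEdge _ _))
        ((mem_edgeSet_addEdge hd₂).2 (Or.inl rfl)) hx hy (hcov₂ x hyx.symm (Or.inl rfl))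
    exact ⟨s(x, y), ⟨hd₂, hnew x, hcm.not_hasMatchingOfSize⟩, Or.inl hcm⟩
  · have hd₂ : ¬ s(c, y).IsDiag := by simpa using hcy
    have hP : ¬ hasMatchingOfSize (k + 1) (addEdge (addEdge G s(c, x)) s(c, y)) := by
      rw [hasMatchingOfSize_iff]
      rintro ⟨M, hM, hMG, hMk⟩
      have hcov₃ : ∀ e ∈ M, ∀ v ∈ e, v = x ∨ v = y ∨ v ∈ edgeSupport N := fun e he =>
        hcov₂ c hcy (Or.inr hc) e (hMG he)
      have hxM : s(c, x) ∈ M ∨ x ∉ edgeSupport M := by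
        by_contra! h
        obtain ⟨e, he, hxe⟩ := mem_edgeSupport.1 h.2
        rcases (mem_edgeSet_addEdge hd₂).1 (hMG he) with rfl | he'
        · rcases Sym2.mem_iff.1 hxe with h | h
          exacts [hcx h.symm, hyx h.symm]
        · rcases (mem_edgeSet_addEdge hd₁).1 he' with rfl | he'
          exacts [h.1 he, hx (hcov _ he' x hxe)]
      have hyM : s(c, y) ∈ M ∨ y ∉ edgeSupport M := by
        by_contra! h
        obtain ⟨e, he, hye⟩ := mem_edgeSupport.1 h.2
        rcases (mem_edgeSet_addEdge hd₂).1 (hMG he) with rfl | he'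
        exacts [h.1 he, (hcov₁ _ he' y hye).elim hyx hy]
      obtain ⟨z, hz⟩ : ∃ z, edgeSupport M ⊆ insert z (edgeSupport N) := by
        by_cases hxs : x ∈ edgeSupport M
        · have hys : y ∉ edgeSupport M := by
            intro hys
            have := hM.2 _ (hxM.resolve_right (not_not.2 hxs)) _
              (hyM.resolve_right (not_not.2 hys)) c (Sym2.mem_mk_left c x) (Sym2.mem_mk_left c y)
            exact hyx (Sym2.congr_right.1 this).symm
          refine ⟨x, fun v hv => ?_⟩
          obtain ⟨e, he, hve⟩ := mem_edgeSupport.1 hv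
          have := hcov₃ e he v hve
          grind
        · refine ⟨y, fun v hv => ?_⟩
          obtain ⟨e, he, hve⟩ := mem_edgeSupport.1 hv
          have := hcov₃ e he v hve
          grind
      have h₁ := Finset.card_le_card hz
      have h₂ := Finset.card_insert_le z (edgeSupport N)
      rw [hM.card_edgeSupport] at h₁
      rw [hN.card_edgeSupport] at h₂
      omega
    refine ⟨s(c, y), ⟨hd₂, hnew c, hP⟩, Or.inr ?_⟩
    refine gameEnsures_of_forall_saturated _ _ hP fun G' hle hP' hend => ?_
    refine card_sub_one_le_ncard_edgeSet (c := c) (adj_of_forall_mem_edgeSupport hP' hend ?_)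
    intro M hM hMG hMk
    exact mem_edgeSupport_of_two_neighbors hP' hN
      (hNG.trans (edgeSet_mono (((le_addEdge G _).trans (le_addEdge _ _)).trans hle))) heq hc hx hy
      hyx.symm (hle (le_addEdge _ _ ((mem_edgeSet_addEdge hd₁).2 (Or.inl rfl))))
      (hle ((mem_edgeSet_addEdge hd₂).2 (Or.inl rfl))) hM hMG hMk

/-- Max, to be the player making the total number of edges congruent to `k`, wins from positions
with a covering matching. -/
lemma HasCoveringMatching.gameEnsures {k : ℕ} (hk : 1 ≤ k) (hV : 2 * (k + 1) ≤ Fintype.card V)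
    (turn : Bool) (G : SimpleGraph V) (h : HasCoveringMatching k G)
    (hpar : turn = true ↔ Odd (G.edgeSet.ncard + k)) :
    GameEnsures (hasMatchingOfSize (k + 1))
      (fun G : SimpleGraph V => Fintype.card V - 1 ≤ G.edgeSet.ncard) turn G := by
  induction hm : G.edgeSetᶜ.ncard using Nat.strong_induction_on generalizing G turn with
  | _ m ih =>
  subst hm
  cases turn with
  | true =>
    obtain ⟨e, he, hcm⟩ := h.exists_move hV (hpar.1 rfl)
    refine .protagonistMove _ e he (ih _ (ncard_compl_edgeSet_addEdge he) false _ hcm ?_ rfl)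
    rw [ncard_edgeSet_addEdge he]
    grind
  | false =>
    obtain ⟨e₀, he₀⟩ := h.exists_legalMove hk hV
    refine .opponentMove _ e₀ he₀ fun e he => ?_
    have hstep : HasCoveringMatching k (addEdge G e) → GameEnsures (hasMatchingOfSize (k + 1))
        (fun G : SimpleGraph V => Fintype.card V - 1 ≤ G.edgeSet.ncard) true (addEdge G e) := by
      intro hcm
      refine ih _ (ncard_compl_edgeSet_addEdge he) true _ hcm ?_ rfl
      rw [ncard_edgeSet_addEdge he]
      grind
    obtain ⟨N, hN, hNG, hNk, hcov⟩ := h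
    have mixed : ∀ c x, e = s(c, x) → c ∈ edgeSupport N → x ∉ edgeSupport N →
        GameEnsures (hasMatchingOfSize (k + 1))
          (fun G : SimpleGraph V => Fintype.card V - 1 ≤ G.edgeSet.ncard) true (addEdge G e) := by
      rintro c x rfl hc hx
      obtain ⟨f, hf, hcm | hwin⟩ := exists_answer hV hN hNG hNk hcov hc hx
      · refine .protagonistMove _ f hf (ih _ ((ncard_compl_edgeSet_addEdge hf).trans
          (ncard_compl_edgeSet_addEdge he)) false _ hcm ?_ rfl)
        rw [ncard_edgeSet_addEdge hf, ncard_edgeSet_addEdge he]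
        grind
      · exact .protagonistMove _ f hf hwin
    induction e with
    | _ a b =>
    have hle := le_addEdge G s(a, b)
    have hadj : (addEdge G s(a, b)).Adj a b := (mem_edgeSet_addEdge he.1).2 (Or.inl rfl)
    by_cases ha : a ∈ edgeSupport N <;> by_cases hb : b ∈ edgeSupport N
    · refine hstep ⟨N, hN, hNG.trans (edgeSet_mono hle), hNk, fun f hf v hv => ?_⟩
      rcases (mem_edgeSet_addEdge he.1).1 hf with rfl | hf
      · rcases Sym2.mem_iff.1 hv with rfl | rfl <;> assumption
      · exact hcov f hf v hv
    · exact mixed a b rfl ha hb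
    · exact mixed b a Sym2.eq_swap hb ha
    · have hlt : N.card < k := by
        refine lt_of_le_of_ne hNk fun heq => he.2.2 (hasMatchingOfSize_iff.2
          ⟨insert s(a, b) N, hN.insert_edge hadj.ne ha hb, ?_, ?_⟩)
        · rw [Finset.coe_insert]
          exact Set.insert_subset hadj (hNG.trans (edgeSet_mono hle))
        · rw [card_insert_of_notMem_edgeSupport ha, heq]
      refine hstep (hasCoveringMatching_of_insert hN hNG hlt hle hadj ha hb fun f hf v hv => ?_)
      rcases (mem_edgeSet_addEdge he.1).1 hf with rfl | hf
      · rcases Sym2.mem_iff.1 hv with h | h <;> simp [h]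
      · exact Or.inr (Or.inr (hcov f hf v hv))

end MatchingGame

/-- In the saturation game `(n, M_k)` with `k ≥ 2` and `n ≥ 2k`: if Max moves first and
`k` is even, or Max moves second (i.e. Mini moves first) and `k` is odd, then Max can
guarantee a final score of at least `n - 1`. -/
theorem statement_5 (k n : ℕ) (hk : 2 ≤ k) (hn : 2 * k ≤ n) :
    (Even k →
      GameEnsures (hasMatchingOfSize k)
        (fun G : SimpleGraph (Fin n) => n - 1 ≤ G.edgeSet.ncard) true ⊥) ∧
    (Odd k →
      GameEnsures (hasMatchingOfSize k)
        (fun G : SimpleGraph (Fin n) => n - 1 ≤ G.edgeSet.ncard) false ⊥) := by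
  obtain ⟨k, rfl⟩ := Nat.exists_eq_add_of_le' (show 1 ≤ k by omega)
  have key := fun turn h => (hasCoveringMatching_bot (V := Fin n) k).gameEnsures
    (by omega) (by simpa using hn) turn _ h
  simp only [Fintype.card_fin] at key
  refine ⟨fun he => key true ?_, fun ho => key false ?_⟩
  · simp only [edgeSet_bot, Set.ncard_empty]
    grind
  · simp only [edgeSet_bot, Set.ncard_empty]
    grind
end

section
/- Let k ≥ 1 be an integer and let n ≥ k. The maximum number of edges of a graph on n vertices that is saturated with respect to the property χ_{>k} of having chromatic number at least k+1 (i.e., χ(G) ≤ k but χ(G+e) ≥ k+1 for every non-edge e) is exactly Σ_{0 ≤ i < j ≤ k−1} ⌊(n+i)/k⌋·⌊(n+j)/k⌋; that is, ex(n, χ_{>k}) = Σ_{0 ≤ i < j ≤ k−1} ⌊(n+i)/k⌋·⌊(n+j)/k⌋. -/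
open SimpleGraph

/-- `G` is saturated with respect to the (monotone increasing) property `P`:
`G` does not satisfy `P`, but adding any non-edge of `G` produces a graph satisfying `P`. -/
def saturatedWrt {V : Type*} (P : SimpleGraph V → Prop) (G : SimpleGraph V) : Prop :=
  ¬ P G ∧ ∀ e : Sym2 V, ¬ e.IsDiag → e ∉ G.edgeSet → P (addEdge G e)

/-- The property of having chromatic number at least `k + 1`. -/
def chiGt {V : Type*} (k : ℕ) (G : SimpleGraph V) : Prop :=
  ((k : ℕ∞) + 1) ≤ G.chromaticNumber

lemma sum_range_add_div {k : ℕ} (hk : 0 < k) (n : ℕ) :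
    ∑ i ∈ Finset.range k, (n + i) / k = n := by
  induction n with
  | zero =>
    refine Finset.sum_eq_zero fun i hi ↦ ?_
    rw [zero_add, Nat.div_eq_of_lt (Finset.mem_range.1 hi)]
  | succ n ih =>
    have h := (Finset.sum_range_succ (fun i ↦ (n + i) / k) k).symm.trans
      (Finset.sum_range_succ' (fun i ↦ (n + i) / k) k)
    simp only [ih, Nat.add_div_right n hk, add_zero] at h
    simp only [add_right_comm n 1, add_assoc n _ 1]
    lia

/-- The sum of `f i * f j` over `i < j < k`. -/
def pairSum (f : ℕ → ℕ) (k : ℕ) : ℕ :=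
  ∑ j ∈ Finset.range k, (∑ i ∈ Finset.range j, f i) * f j

lemma pairSum_succ (f : ℕ → ℕ) (k : ℕ) :
    pairSum f (k + 1) = pairSum f k + (∑ i ∈ Finset.range k, f i) * f k :=
  Finset.sum_range_succ ..

lemma pairSum_succ' (f : ℕ → ℕ) (k : ℕ) :
    pairSum f (k + 1) =
      pairSum (fun i ↦ f (i + 1)) k + f 0 * ∑ i ∈ Finset.range k, f (i + 1) := by
  simp only [pairSum, Finset.sum_range_succ', Finset.mul_sum, Finset.sum_range_zero, zero_mul,
    add_zero, add_mul, Finset.sum_add_distrib]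

lemma sum_ite_lt_eq_pairSum (f : ℕ → ℕ) (k : ℕ) :
    (∑ i ∈ Finset.range k, ∑ j ∈ Finset.range k, if i < j then f i * f j else 0) =
      pairSum f k := by
  rw [Finset.sum_comm, pairSum]
  refine Finset.sum_congr rfl fun j hj ↦ ?_
  rw [← Finset.sum_filter, Finset.sum_mul]
  refine Finset.sum_congr ?_ fun _ _ ↦ rfl
  ext i
  simp only [Finset.mem_filter, Finset.mem_range] at hj ⊢
  lia

lemma pairSum_add_div {k : ℕ} (hk : 0 < k) (n : ℕ) :
    pairSum (fun i ↦ (n + i) / k) k + ∑ m ∈ Finset.range n, m / k =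
      ∑ m ∈ Finset.range n, m := by
  induction n with
  | zero =>
    simp only [Finset.sum_range_zero, add_zero, zero_add]
    refine Finset.sum_eq_zero fun j hj ↦ ?_
    simp only [Nat.div_eq_of_lt (Finset.mem_range.1 hj), mul_zero]
  | succ n ih =>
    have h := (pairSum_succ (fun i ↦ (n + i) / k) k).symm.trans
      (pairSum_succ' (fun i ↦ (n + i) / k) k)
    have e : (fun i ↦ (n + (i + 1)) / k) = fun i ↦ (n + 1 + i) / k :=
      funext fun i ↦ by rw [add_assoc, add_comm 1]
    rw [e, sum_range_add_div hk, sum_range_add_div hk (n + 1)] at h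
    simp only [Nat.add_div_right n hk, add_zero] at h
    rw [Finset.sum_range_succ, Finset.sum_range_succ, ← ih]
    grind

lemma card_edgeFinset_turanGraph_add_sum_div {k : ℕ} (hk : 0 < k) (n : ℕ) :
    (turanGraph n k).edgeFinset.card + ∑ m ∈ Finset.range n, m / k =
      ∑ m ∈ Finset.range n, m := by
  induction n using Nat.strong_induction_on with
  | _ n ih =>
    rcases lt_or_ge n k with h | h
    · have hs : ∑ m ∈ Finset.range n, m / k = 0 := Finset.sum_eq_zero fun m hm ↦
        Nat.div_eq_of_lt ((Finset.mem_range.1 hm).trans h)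
      have ht : (turanGraph n k).edgeFinset.card = n.choose 2 := by
        have := card_edgeFinset_top_eq_card_choose_two (V := Fin n)
        rw [Fintype.card_fin] at this
        convert! this
        exact turanGraph_eq_top.2 (.inr h.le)
      rw [hs, ht, add_zero, Finset.sum_range_id, Nat.choose_two_right]
    · obtain ⟨n, rfl⟩ := Nat.exists_eq_add_of_le' h
      rw [card_edgeFinset_turanGraph_add, Finset.sum_range_add, Finset.sum_range_add,
        sum_range_add_div hk, ← ih n (by lia), Finset.sum_add_distrib, Finset.sum_const,
        Finset.card_range, smul_eq_mul, Finset.sum_range_id, Nat.choose_two_right]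
      obtain ⟨k, rfl⟩ := Nat.exists_eq_add_of_le' hk
      rw [Nat.add_sub_cancel]
      lia

lemma card_edgeFinset_turanGraph_eq_pairSum {k : ℕ} (hk : 0 < k) (n : ℕ) :
    (turanGraph n k).edgeFinset.card = pairSum (fun i ↦ (n + i) / k) k :=
  Nat.add_right_cancel
    ((card_edgeFinset_turanGraph_add_sum_div hk n).trans (pairSum_add_div hk n).symm)

lemma turanGraph_colorable {k : ℕ} (hk : 0 < k) (n : ℕ) : (turanGraph n k).Colorable k :=
  ⟨Coloring.mk (fun v ↦ ⟨v % k, Nat.mod_lt _ hk⟩) fun h h' ↦ h (congrArg Fin.val h')⟩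

lemma chiGt_iff_not_colorable {V : Type*} {k : ℕ} {G : SimpleGraph V} :
    chiGt k G ↔ ¬ G.Colorable k := by
  rw [chiGt, ENat.add_one_le_iff (ENat.natCast_ne_top k), ← not_le,
    chromaticNumber_le_iff_colorable]

lemma lt_addEdge {V : Type*} {G : SimpleGraph V} {e : Sym2 V} (hd : ¬ e.IsDiag)
    (he : e ∉ G.edgeSet) : G < addEdge G e := by
  refine left_lt_sup.2 fun h ↦ he (edgeSet_subset_edgeSet.2 h ?_)
  rw [edgeSet_fromEdgeSet]
  exact ⟨rfl, hd⟩

/-- For `k ≥ 1` and `n ≥ k`, the maximum number of edges of a graph on `n` vertices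
saturated with respect to the property of having chromatic number at least `k + 1` is
exactly `Σ_{0 ≤ i < j ≤ k-1} ⌊(n+i)/k⌋ ⌊(n+j)/k⌋` (`/` is floor division on `ℕ`). -/
theorem statement_11 (k n : ℕ) (hk : 1 ≤ k) (hn : k ≤ n) :
    IsGreatest
      {m : ℕ | ∃ G : SimpleGraph (Fin n),
        saturatedWrt (chiGt k) G ∧ G.edgeSet.ncard = m}
      (∑ i ∈ Finset.range k, ∑ j ∈ Finset.range k,
        if i < j then ((n + i) / k) * ((n + j) / k) else 0) := by
  have hT := isTuranMaximal_turanGraph (n := n) hk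
  rw [sum_ite_lt_eq_pairSum (fun i ↦ (n + i) / k),
    ← card_edgeFinset_turanGraph_eq_pairSum hk]
  constructor
  · refine ⟨turanGraph n k, ⟨?_, fun e hd he ↦ ?_⟩, ?_⟩
    · simpa only [chiGt_iff_not_colorable, not_not] using turanGraph_colorable hk n
    · rw [chiGt_iff_not_colorable]
      intro hc
      classical
      exact (Finset.card_lt_card (edgeFinset_ssubset_edgeFinset.2 (lt_addEdge hd he))).not_ge
        (hT.2 (hc.cliqueFree (Nat.lt_succ_self k)))
    · rw [← coe_edgeFinset, Set.ncard_coe_finset]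
  · rintro m ⟨G, ⟨hG, -⟩, rfl⟩
    classical
    rw [chiGt_iff_not_colorable, not_not] at hG
    rw [← coe_edgeFinset, Set.ncard_coe_finset]
    exact hT.2 (hG.cliqueFree (Nat.lt_succ_self k))
end
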